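/- arXiv:2105.12930 — 4 statements merged into one kernel-verified Lean document; each statement's English description precedes it below -/
import Mathlib

section
/- Let H be a finite group and g ∈ H. Let zcl(g) = {x ∈ H : Z_H(x) is conjugate in H to Z_H(g)} be the z-class of g and cl(g) the conjugacy class of g in H. Then |zcl(g)| ≤ |cl(g)| · |Z(Z_H(g))|, where Z(Z_H(g)) is the center of the centralizer of g. -/
/-- If `x` and `c * g * c⁻¹` have the same centralizer, then `c⁻¹ * x * c` is central in the
centralizer of `g`. -/
theorem exists_mem_center_centralizer_of_centralizer_eq {H : Type*} [Group H] {g x c : H}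
    (hx : ∀ k : H, Commute x k ↔ Commute (c * g * c⁻¹) k) :
    ∃ z : Subgroup.center (Subgroup.centralizer {g}), c * (z : H) * c⁻¹ = x := by
  have key : ∀ k : H, Commute (c⁻¹ * x * c) k ↔ Commute g k := fun k => by
    rw [← Commute.conj_iff c, ← Commute.conj_iff (a := g) c, ← hx]
    simp [mul_assoc]
  have hmem : c⁻¹ * x * c ∈ Subgroup.centralizer {g} :=
    Subgroup.mem_centralizer_singleton_iff.2 ((key _).1 (Commute.refl _)).symm.eq
  refine ⟨⟨⟨_, hmem⟩, Subgroup.mem_center_iff.2 fun k => Subtype.ext ?_⟩, by simp [mul_assoc]⟩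
  exact ((key k).2 (Subgroup.mem_centralizer_singleton_iff.1 k.2 : Commute (k : H) g).symm).symm.eq

/-- For a finite group `H` and `g ∈ H`, `|zcl(g)| ≤ |cl(g)| · |Z(Z_H(g))|`. -/
theorem card_zclass_le_card_class_mul_card_center {H : Type*} [Group H] [Finite H] (g : H) :
    Nat.card {x : H | ∃ h : H,
        Subgroup.centralizer {x} =
          Subgroup.map (MulAut.conj h).toMonoidHom (Subgroup.centralizer {g})} ≤
      Nat.card {x : H | IsConj g x} *
        Nat.card (Subgroup.center ↥(Subgroup.centralizer {g})) := by
  have hconj : ∀ y : {x : H | IsConj g x}, ∃ c : H, c * g * c⁻¹ = y := fun y => isConj_iff.1 y.2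
  choose c hc using hconj
  let f : {x : H | IsConj g x} × Subgroup.center (Subgroup.centralizer {g}) → H :=
    fun p => c p.1 * (p.2 : H) * (c p.1)⁻¹
  rw [← Nat.card_prod]
  refine (Nat.card_mono (t := Set.range f) (Set.toFinite _) ?_).trans (Finite.card_range_le f)
  rintro x ⟨h, hx⟩
  let y : {x : H | IsConj g x} := ⟨h * g * h⁻¹, isConj_iff.2 ⟨h, rfl⟩⟩
  obtain ⟨z, hz⟩ := exists_mem_center_centralizer_of_centralizer_eq (g := g) (x := x) (c := c y)
    fun k => by
      rw [hc y, ← Commute.conj_iff (a := h * g * h⁻¹) h⁻¹]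
      have hk := SetLike.ext_iff.1 hx k
      rw [Subgroup.mem_centralizer_singleton_iff, Subgroup.mem_map_equiv,
        Subgroup.mem_centralizer_singleton_iff] at hk
      change Commute k x ↔ Commute ((MulAut.conj h).symm k) g at hk
      rw [Commute.symm_iff, hk, Commute.symm_iff]
      simp [mul_assoc]
  exact ⟨(y, z), hz⟩
end

section
/- Let F be a field, let l ≥ 2, and let λ_1, ..., λ_l be pairwise distinct elements of F. Let Λ = diag(λ_1, ..., λ_l), and let N be the l × l cyclic permutation matrix with N_{1,l} = 1, N_{i+1,i} = 1 for 1 ≤ i ≤ l - 1, and all other entries 0. Then the common centralizer in GL_{2l}(F) of the three commuting elements u_1 = (I_l, I_l; 0, I_l), u_2 = (I_l, Λ; 0, I_l), u_3 = (I_l, N; 0, I_l) equals the abelian subgroup A = {(λ I_l, X; 0, λ I_l) : λ ∈ F nonzero, X an arbitrary l × l matrix over F}. -/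
/-- A unipotent block matrix commutes with a block matrix iff its corner satisfies the
evident intertwining relations. -/
theorem Matrix.fromBlocks_one_zero_one_mul_comm_iff {R n : Type*} [Ring R] [Fintype n]
    [DecidableEq n] (M A B C D : Matrix n n R) :
    fromBlocks 1 M 0 1 * fromBlocks A B C D = fromBlocks A B C D * fromBlocks 1 M 0 1 ↔
      M * C = 0 ∧ C * M = 0 ∧ M * D = A * M := by
  simp only [fromBlocks_multiply, fromBlocks_inj, one_mul, zero_mul, mul_one, mul_zero, zero_add,
    add_zero, add_eq_left, true_and]
  rw [add_comm (A * M) B, add_right_inj, right_eq_add]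
  tauto

/-- A matrix commuting with a diagonal matrix with distinct entries is diagonal. -/
theorem Matrix.apply_eq_zero_of_diagonal_mul_comm {F n : Type*} [Field F] [Fintype n]
    [DecidableEq n] {d : n → F} (hd : Function.Injective d) {A : Matrix n n F}
    (h : diagonal d * A = A * diagonal d) {i j : n} (hij : i ≠ j) : A i j = 0 := by
  have hA := congr_fun₂ h i j
  rw [diagonal_mul, mul_diagonal, mul_comm (A i j)] at hA
  by_contra h0
  exact hij (hd (mul_right_cancel₀ h0 hA))

/-- A diagonal matrix commuting with the cyclic permutation matrix is scalar. -/
theorem Matrix.apply_self_eq_of_cyclic_mul_comm {F : Type*} [Field F] {l : ℕ} (hl : 1 < l)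
    {A : Matrix (Fin l) (Fin l) F} (hA : ∀ i j, i ≠ j → A i j = 0)
    (h : (of fun i j : Fin l => if i = j + ⟨1, hl⟩ then (1 : F) else 0) * A =
      A * of fun i j : Fin l => if i = j + ⟨1, hl⟩ then (1 : F) else 0) (i : Fin l) :
    A i i = A ⟨0, by omega⟩ ⟨0, by omega⟩ := by
  have step (j : Fin l) : A (j + ⟨1, hl⟩) (j + ⟨1, hl⟩) = A j j := by
    have hj := congr_fun₂ h (j + ⟨1, hl⟩) j
    rw [mul_apply, mul_apply, Finset.sum_eq_single j (fun k _ hk => by rw [hA k j hk, mul_zero])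
      (by simp)] at hj
    simpa using hj.symm
  obtain ⟨k, hk⟩ := i
  induction k with
  | zero => rfl
  | succ k ih =>
    have hs : (⟨k, by omega⟩ : Fin l) + ⟨1, hl⟩ = ⟨k + 1, hk⟩ := by
      ext
      simp [Fin.val_add, Nat.mod_eq_of_lt hk]
    rw [← hs, step, ih]

/-- For a field `F`, `l ≥ 2`, and pairwise distinct `λ_1, ..., λ_l ∈ F`, the common
centralizer in `GL_{2l}(F)` of the three commuting unipotent elements
`u₁ = (I, I; 0, I)`, `u₂ = (I, Λ; 0, I)`, `u₃ = (I, N; 0, I)` (with `Λ = diag(λ_1,...,λ_l)`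
and `N` the cyclic permutation matrix) is the abelian subgroup
`A = {(λ I, X; 0, λ I) : λ ∈ F*, X arbitrary}`. -/
theorem centralizer_of_triple_eq_maxAbelian {F : Type*} [Field F] (l : ℕ) (hl : 2 ≤ l)
    (lam : Fin l → F) (hlam : Function.Injective lam)
    (u₁ u₂ u₃ : GL (Fin l ⊕ Fin l) F)
    (h₁ : (↑u₁ : Matrix (Fin l ⊕ Fin l) (Fin l ⊕ Fin l) F) = Matrix.fromBlocks 1 1 0 1)
    (h₂ : (↑u₂ : Matrix (Fin l ⊕ Fin l) (Fin l ⊕ Fin l) F) =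
      Matrix.fromBlocks 1 (Matrix.diagonal lam) 0 1)
    (h₃ : (↑u₃ : Matrix (Fin l ⊕ Fin l) (Fin l ⊕ Fin l) F) =
      Matrix.fromBlocks 1
        (Matrix.of fun i j : Fin l => if i = j + ⟨1, by omega⟩ then (1 : F) else 0) 0 1) :
    (Subgroup.centralizer {u₁, u₂, u₃} : Set (GL (Fin l ⊕ Fin l) F)) =
      {g : GL (Fin l ⊕ Fin l) F | ∃ (c : F) (X : Matrix (Fin l) (Fin l) F), c ≠ 0 ∧
        (↑g : Matrix (Fin l ⊕ Fin l) (Fin l ⊕ Fin l) F) =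
          Matrix.fromBlocks (c • 1) X 0 (c • 1)} := by
  ext g
  obtain ⟨A, B, C, D, hg⟩ : ∃ A B C D, (↑g : Matrix (Fin l ⊕ Fin l) (Fin l ⊕ Fin l) F) =
      Matrix.fromBlocks A B C D := ⟨_, _, _, _, (Matrix.fromBlocks_toBlocks _).symm⟩
  have key : g ∈ Subgroup.centralizer {u₁, u₂, u₃} ↔
      u₁ * g = g * u₁ ∧ u₂ * g = g * u₂ ∧ u₃ * g = g * u₃ := by
    simp [Subgroup.mem_centralizer_iff]
  rw [SetLike.mem_coe, key, Set.mem_ofPred_eq]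
  simp only [Units.ext_iff, Units.val_mul, h₁, h₂, h₃, hg,
    Matrix.fromBlocks_one_zero_one_mul_comm_iff, Matrix.fromBlocks_inj]
  constructor
  · rintro ⟨⟨hC, -, hDA⟩, ⟨-, -, hΛ⟩, -, -, hN⟩
    rw [one_mul] at hC
    rw [one_mul, mul_one] at hDA
    subst hC hDA
    have hoff : ∀ i j, i ≠ j → D i j = 0 := fun i j =>
      Matrix.apply_eq_zero_of_diagonal_mul_comm hlam hΛ
    have hdiag := Matrix.apply_self_eq_of_cyclic_mul_comm hl hoff hN
    have hD : D = D ⟨0, by omega⟩ ⟨0, by omega⟩ • (1 : Matrix (Fin l) (Fin l) F) := by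
      ext i j
      by_cases hij : i = j
      · subst hij
        simpa using hdiag i
      · simp [hij, hoff i j hij]
    refine ⟨_, B, fun h0 => ?_, hD, rfl, rfl, hD⟩
    rw [h0, zero_smul] at hD
    subst hD
    have hdet : IsUnit (g : Matrix (Fin l ⊕ Fin l) (Fin l ⊕ Fin l) F).det :=
      (Matrix.isUnit_iff_isUnit_det _).mp g.isUnit
    have : Nonempty (Fin l) := ⟨⟨0, by omega⟩⟩
    rw [hg, Matrix.det_fromBlocks_zero₂₁, Matrix.det_zero, zero_mul] at hdet
    exact not_isUnit_zero hdet
  · rintro ⟨c, X, -, rfl, rfl, rfl, rfl⟩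
    simp
end

section
/- Let K be an algebraically closed field. Define two elements g, h of GL_2(K) to be z-equivalent if their centralizers Z(g) and Z(h) in GL_2(K) are conjugate subgroups of GL_2(K). Then this equivalence relation has exactly 3 equivalence classes, represented by the identity matrix I, the matrix (1, 1; 0, 1), and a diagonal matrix diag(λ_1, λ_2) with λ_1 ≠ λ_2. -/
/-- Two elements of a group are `z`-equivalent if their centralizers are conjugate. -/
def IsZEquiv {G : Type*} [Group G] (g h : G) : Prop :=
  ∃ x : G, Subgroup.centralizer {g} =
    Subgroup.map (MulAut.conj x).toMonoidHom (Subgroup.centralizer {h})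

namespace ZClassesGL2

theorem mem_map_conj_centralizer_iff {G : Type*} [Group G] (x y h : G) :
    y ∈ Subgroup.map (MulAut.conj x).toMonoidHom (Subgroup.centralizer {h}) ↔
      Commute (x⁻¹ * y * x) h := by
  rw [Subgroup.mem_map]
  constructor
  · rintro ⟨z, hz, rfl⟩
    rw [Subgroup.mem_centralizer_singleton_iff] at hz
    simpa [commute_iff_eq, mul_assoc] using hz
  · intro hy
    exact ⟨x⁻¹ * y * x, Subgroup.mem_centralizer_singleton_iff.2 hy, by simp [mul_assoc]⟩

theorem isZEquiv_one_iff {G : Type*} [Group G] (h : G) :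
    IsZEquiv 1 h ↔ ∀ y : G, Commute y h := by
  constructor
  · rintro ⟨x, hx⟩ y
    have hy : x * y * x⁻¹ ∈ Subgroup.centralizer {(1 : G)} := by
      simp [Subgroup.mem_centralizer_singleton_iff]
    rw [hx, mem_map_conj_centralizer_iff] at hy
    simpa [mul_assoc] using hy
  · refine fun hh => ⟨1, Subgroup.ext fun y => ?_⟩
    rw [mem_map_conj_centralizer_iff, Subgroup.mem_centralizer_singleton_iff]
    simp [hh y]

theorem isZEquiv_of_conj {n K : Type*} [Fintype n] [DecidableEq n] [Field K] {g h : GL n K}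
    (x : GL n K) (c d : K) (hd : d ≠ 0)
    (hx : (g : Matrix n n K) * x = x * (c • (1 : Matrix n n K) + d • (h : Matrix n n K))) :
    IsZEquiv g h := by
  refine ⟨x, Subgroup.ext fun y => ?_⟩
  have hg : ((x⁻¹ * g * x : GL n K) : Matrix n n K) = c • 1 + d • (h : Matrix n n K) := by
    rw [Units.val_mul, Units.val_mul, mul_assoc, hx, Units.inv_mul_cancel_left]
  have hconj : Commute y g ↔ Commute (x⁻¹ * y * x) (x⁻¹ * g * x) := by
    simpa using (Commute.conj_iff x⁻¹ (a := y) (b := g)).symm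
  rw [mem_map_conj_centralizer_iff, Subgroup.mem_centralizer_singleton_iff]
  change Commute y g ↔ _
  rw [hconj, ← Commute.units_val_iff, ← Commute.units_val_iff (u₂ := h), hg]
  simp [commute_iff_eq, mul_add, add_mul, hd]

theorem isZEquiv_of_conj_fin_two {K : Type*} [Field K] {g h : GL (Fin 2) K}
    (X : Matrix (Fin 2) (Fin 2) K) (hX : X.det ≠ 0) (c d : K) (hd : d ≠ 0)
    (hx : (g : Matrix (Fin 2) (Fin 2) K) * X =
      X * (c • (1 : Matrix (Fin 2) (Fin 2) K) + d • (h : Matrix (Fin 2) (Fin 2) K))) :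
    IsZEquiv g h :=
  isZEquiv_of_conj (Matrix.GeneralLinearGroup.mkOfDetNeZero X hX) c d hd hx

theorem isZEquiv_one_of_scalar {n K : Type*} [Fintype n] [DecidableEq n] [Field K] {g : GL n K}
    (c : K) (hg : (g : Matrix n n K) = c • 1) : IsZEquiv g 1 := by
  refine ⟨1, Subgroup.ext fun y => ?_⟩
  rw [mem_map_conj_centralizer_iff, Subgroup.mem_centralizer_singleton_iff]
  simp only [Commute.one_right, iff_true]
  ext1
  simp [hg]

theorem exists_root_charpoly_fin_two {K : Type*} [Field K] [IsAlgClosed K] (A B C D : K) :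
    ∃ a b : K, a + b = A + D ∧ a * b = A * D - B * C := by
  have hdeg : (Matrix.charpoly !![A, B; C, D]).degree ≠ 0 := by
    rw [Matrix.charpoly_degree_eq_dim]; simp
  obtain ⟨a, ha⟩ := IsAlgClosed.exists_root _ hdeg
  rw [Matrix.charpoly_fin_two] at ha
  simp [Polynomial.IsRoot, Matrix.trace_fin_two, Matrix.det_fin_two] at ha
  exact ⟨a, A + D - a, by ring, by linear_combination -ha⟩

theorem isZEquiv_unipotent {K : Type*} [Field K] {g u : GL (Fin 2) K} {A B C D a : K}
    (hg : (g : Matrix (Fin 2) (Fin 2) K) = !![A, B; C, D])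
    (hu : (u : Matrix (Fin 2) (Fin 2) K) = !![1, 1; 0, 1])
    (hs : a + a = A + D) (hp : a * a = A * D - B * C) (hBC : C = 0 → B ≠ 0) :
    IsZEquiv g u := by
  by_cases hC : C = 0
  · subst hC
    have hA : A = a := by
      have : (A - a) ^ 2 = 0 := by linear_combination -A * hs + hp
      exact sub_eq_zero.1 (pow_eq_zero_iff two_ne_zero |>.1 this)
    have hD : D = a := by linear_combination -hs - hA
    refine isZEquiv_of_conj_fin_two !![B, 0; 0, 1] (by simpa using hBC rfl) (a - 1) 1
      one_ne_zero ?_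
    rw [hg, hu]
    ext i j
    fin_cases i <;> fin_cases j <;> simp [Matrix.mul_apply, hA, hD, mul_comm]
  · refine isZEquiv_of_conj_fin_two !![A - a, 1; C, 0] (by simpa using hC) (a - 1) 1
      one_ne_zero ?_
    rw [hg, hu]
    ext i j
    fin_cases i <;> fin_cases j <;> simp [Matrix.mul_apply]
    · linear_combination -A * hs + hp
    · linear_combination -C * hs

theorem isZEquiv_diagonal {K : Type*} [Field K] {g t : GL (Fin 2) K} {A B C D a b l m : K}
    (hg : (g : Matrix (Fin 2) (Fin 2) K) = !![A, B; C, D])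
    (ht : (t : Matrix (Fin 2) (Fin 2) K) = !![l, 0; 0, m]) (hlm : l ≠ m)
    (hs : a + b = A + D) (hp : a * b = A * D - B * C) (hab : a ≠ b) :
    IsZEquiv g t := by
  have hlm' := sub_ne_zero.2 hlm
  have hab' := sub_ne_zero.2 hab
  have key : ∀ (X : Matrix (Fin 2) (Fin 2) K) (a b : K), X.det ≠ 0 → a ≠ b →
      (g : Matrix (Fin 2) (Fin 2) K) * X = X * !![a, 0; 0, b] → IsZEquiv g t := by
    intro X a b hX hab hgX
    refine isZEquiv_of_conj_fin_two X hX (a - (a - b) / (l - m) * l) ((a - b) / (l - m))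
      (div_ne_zero (sub_ne_zero.2 hab) hlm') ?_
    rw [hgX, ht]
    congr 1
    ext i j
    fin_cases i <;> fin_cases j <;> simp
    field_simp
    ring
  by_cases hC : C = 0
  · by_cases hB : B = 0
    · subst hB hC
      refine key 1 A D (by simp) ?_ (by simp [hg])
      rintro rfl
      refine hab' (pow_eq_zero_iff two_ne_zero |>.1 ?_)
      linear_combination (a + b + A + A) * hs - 4 * hp
    · refine key !![B, B; a - A, b - A] a b ?_ hab ?_
      · rw [Matrix.det_fin_two_of]
        convert mul_ne_zero hB (neg_ne_zero.2 hab') using 1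
        ring
      · rw [hg]
        ext i j
        fin_cases i <;> fin_cases j <;> simp [Matrix.mul_apply]
        · ring
        · ring
        · linear_combination -a * hs + hp
        · linear_combination -b * hs + hp
  · refine key !![a - D, b - D; C, C] a b ?_ hab ?_
    · rw [Matrix.det_fin_two_of]
      convert mul_ne_zero hC hab' using 1
      ring
    · rw [hg]
      ext i j
      fin_cases i <;> fin_cases j <;> simp [Matrix.mul_apply]
      · linear_combination -a * hs + hp
      · linear_combination -b * hs + hp
      · ring
      · ring

theorem not_isZEquiv_unipotent_diagonal {K : Type*} [Field K] {u t : GL (Fin 2) K} {l m : K}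
    (hu : (u : Matrix (Fin 2) (Fin 2) K) = !![1, 1; 0, 1])
    (ht : (t : Matrix (Fin 2) (Fin 2) K) = !![l, 0; 0, m]) (hlm : l ≠ m) :
    ¬ IsZEquiv u t := by
  rintro ⟨x, hx⟩
  have hmem : x * t * x⁻¹ ∈ Subgroup.centralizer {u} := by
    rw [hx, mem_map_conj_centralizer_iff]
    simp [mul_assoc]
  rw [Subgroup.mem_centralizer_singleton_iff] at hmem
  have hM := congrArg Units.val hmem
  have htr : (((x * t * x⁻¹ : GL (Fin 2) K)) : Matrix (Fin 2) (Fin 2) K).trace = l + m := by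
    rw [Units.val_mul, Units.val_mul, Matrix.trace_units_conj, ht, Matrix.trace_fin_two_of]
  have hdet : (((x * t * x⁻¹ : GL (Fin 2) K)) : Matrix (Fin 2) (Fin 2) K).det = l * m := by
    rw [Units.val_mul, Units.val_mul, Matrix.det_units_conj, ht, Matrix.det_fin_two_of]
    ring
  rw [Units.val_mul, Units.val_mul u, hu] at hM
  generalize ((x * t * x⁻¹ : GL (Fin 2) K) : Matrix (Fin 2) (Fin 2) K) = M at hM htr hdet
  have h00 := congrFun (congrFun hM 0) 0
  have h01 := congrFun (congrFun hM 0) 1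
  simp [Matrix.mul_apply] at h00 h01
  rw [Matrix.trace_fin_two] at htr
  rw [Matrix.det_fin_two, h00] at hdet
  refine sub_ne_zero.2 hlm (pow_eq_zero_iff two_ne_zero |>.1 ?_)
  have h11 : M 1 1 = M 0 0 := by linear_combination -h01
  rw [h11] at htr hdet
  linear_combination -(l + m + 2 * M 0 0) * htr + 4 * hdet

end ZClassesGL2

open ZClassesGL2 in
/-- Over an algebraically closed field `K`, `GL₂(K)` has exactly `3` `z`-classes, represented
by the identity, the unipotent Jordan block `(1,1;0,1)`, and a diagonal matrix with distinct
eigenvalues. -/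
theorem zclasses_GL2 {K : Type*} [Field K] [IsAlgClosed K]
    (lam₁ lam₂ : K) (hne : lam₁ ≠ lam₂) (u t : GL (Fin 2) K)
    (hu : (↑u : Matrix (Fin 2) (Fin 2) K) = !![1, 1; 0, 1])
    (ht : (↑t : Matrix (Fin 2) (Fin 2) K) = !![lam₁, 0; 0, lam₂]) :
    (∀ g : GL (Fin 2) K, IsZEquiv g 1 ∨ IsZEquiv g u ∨ IsZEquiv g t) ∧
      ¬ IsZEquiv 1 u ∧ ¬ IsZEquiv 1 t ∧ ¬ IsZEquiv u t := by
  refine ⟨fun g => ?_, ?_, ?_, not_isZEquiv_unipotent_diagonal hu ht hne⟩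
  · have hg := Matrix.eta_fin_two (g : Matrix (Fin 2) (Fin 2) K)
    obtain ⟨a, b, hs, hp⟩ := exists_root_charpoly_fin_two (g 0 0) (g 0 1) (g 1 0) (g 1 1)
    by_cases hab : a = b
    · subst hab
      by_cases hBC : g 1 0 = 0 → g 0 1 ≠ 0
      · exact .inr (.inl (isZEquiv_unipotent hg hu hs hp hBC))
      · push Not at hBC
        obtain ⟨hC, hB⟩ := hBC
        have hA : g 0 0 = a := by
          have : (g 0 0 - a) ^ 2 = 0 := by linear_combination -g 0 0 * hs + hp - g 1 0 * hB
          exact sub_eq_zero.1 (pow_eq_zero_iff two_ne_zero |>.1 this)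
        have hD : g 1 1 = a := by linear_combination -hs - hA
        refine .inl (isZEquiv_one_of_scalar a ?_)
        rw [hg, hA, hB, hC, hD, Matrix.one_fin_two]
        simp
    · exact .inr (.inr (isZEquiv_diagonal hg ht hne hs hp hab))
  · rw [isZEquiv_one_iff]
    intro h
    have hM := congrArg Units.val
      (h (Matrix.GeneralLinearGroup.mkOfDetNeZero !![1, 0; 1, 1] (by simp))).eq
    rw [Units.val_mul, Units.val_mul, hu] at hM
    have h00 := congrFun (congrFun hM 0) 0
    simp [Matrix.GeneralLinearGroup.mkOfDetNeZero, Matrix.mul_apply] at h00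
  · rw [isZEquiv_one_iff]
    intro h
    have hM := congrArg Units.val (h u).eq
    rw [Units.val_mul, Units.val_mul, hu, ht] at hM
    have h01 := congrFun (congrFun hM 0) 1
    simp [Matrix.mul_apply] at h01
    exact hne h01.symm
end

section
/- Let K be an algebraically closed field. Define two elements g, h of GL_3(K) to be z-equivalent if their centralizers Z(g) and Z(h) in GL_3(K) are conjugate subgroups of GL_3(K). Then this equivalence relation has exactly 6 equivalence classes, represented by a I_3; the matrix with diagonal (a, a, a) and a single Jordan block of size 2; diag(a, a, b); a single Jordan block of size 3 with eigenvalue a; the matrix with a Jordan block of size 2 for eigenvalue a together with the diagonal entry b; and diag(a, b, c) with a, b, c pairwise distinct (where a ≠ b are nonzero). -/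
namespace ZClassesGL3

open Matrix

variable {K : Type*} [Field K]

/-- `P` conjugates `M` into `J`, for some invertible `P`. -/
def IsSimilar (M J : Matrix (Fin 3) (Fin 3) K) : Prop :=
  ∃ P : Matrix (Fin 3) (Fin 3) K, P.det ≠ 0 ∧ M * P = P * J

theorem IsSimilar.trans {M N J : Matrix (Fin 3) (Fin 3) K} (h : IsSimilar M N)
    (h' : IsSimilar N J) : IsSimilar M J := by
  obtain ⟨P, hP, e⟩ := h
  obtain ⟨Q, hQ, e'⟩ := h'
  refine ⟨P * Q, by simp [hP, hQ], ?_⟩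
  rw [← Matrix.mul_assoc, e, Matrix.mul_assoc, e', Matrix.mul_assoc]

theorem isZEquiv_of_isSimilar {g h : GL (Fin 3) K} {J : Matrix (Fin 3) (Fin 3) K}
    (hs : IsSimilar (g : Matrix (Fin 3) (Fin 3) K) J)
    (hJ : ∀ Y : Matrix (Fin 3) (Fin 3) K, Commute Y J ↔ Commute Y h) : IsZEquiv g h := by
  obtain ⟨P, hP, e⟩ := hs
  let x : GL (Fin 3) K := Matrix.GeneralLinearGroup.mkOfDetNeZero P hP
  have e1 : (g : Matrix (Fin 3) (Fin 3) K) = x * J * (x⁻¹ : GL (Fin 3) K) := by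
    rw [show (x : Matrix (Fin 3) (Fin 3) K) * J = g * x from e.symm, Matrix.mul_assoc,
      Units.mul_inv, Matrix.mul_one]
  refine ⟨x, ?_⟩
  ext y
  rw [Subgroup.mem_map_equiv, Subgroup.mem_centralizer_singleton_iff,
    Subgroup.mem_centralizer_singleton_iff, MulAut.conj_symm_apply]
  have key := hJ (x⁻¹ * y * x : GL (Fin 3) K)
  have r : (x⁻¹ * y * x) * h = h * (x⁻¹ * y * x) ↔
      Commute ((x⁻¹ * y * x : GL (Fin 3) K) : Matrix (Fin 3) (Fin 3) K) h := by
    rw [Units.ext_iff]; rfl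
  have l : y * g = g * y ↔
      Commute ((x⁻¹ * y * x : GL (Fin 3) K) : Matrix (Fin 3) (Fin 3) K) J := by
    rw [Units.ext_iff, commute_iff_eq]
    simp only [Units.val_mul, e1]
    rw [← Units.mul_right_inj x⁻¹, ← Units.mul_left_inj x]
    simp only [mul_assoc, Units.inv_mul, Units.inv_mul_cancel_left, mul_one]
  rw [l, r, key]

theorem isZEquiv_symm {G : Type*} [Group G] {g h : G} (H : IsZEquiv g h) : IsZEquiv h g := by
  obtain ⟨x, hx⟩ := H
  refine ⟨x⁻¹, ?_⟩
  rw [hx, Subgroup.map_map]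
  convert (Subgroup.map_id _).symm using 2
  ext y
  simp [mul_assoc]

/-- If `g` and `h` are `z`-equivalent, some conjugate `k` of `h` commutes with the centralizer
of `g`, and `h` is annihilated by every split polynomial of degree at most `3` annihilating `k`. -/
theorem exists_commute_of_isZEquiv {g h : GL (Fin 3) K} (H : IsZEquiv g h) :
    ∃ k : Matrix (Fin 3) (Fin 3) K,
      (∀ s t u : K, (k - scalar _ s) * (k - scalar _ t) * (k - scalar _ u) = 0 →
        ((h : Matrix (Fin 3) (Fin 3) K) - scalar _ s) * (h.1 - scalar _ t) * (h.1 - scalar _ u) = 0) ∧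
      (∀ s t : K, (k - scalar _ s) * (k - scalar _ t) = 0 →
        ((h : Matrix (Fin 3) (Fin 3) K) - scalar _ s) * (h.1 - scalar _ t) = 0) ∧
      (∀ s : K, k - scalar _ s = 0 → (h : Matrix (Fin 3) (Fin 3) K) - scalar _ s = 0) ∧
      ∀ Y : Matrix (Fin 3) (Fin 3) K, Y.det ≠ 0 → Commute Y g → Commute Y k := by
  obtain ⟨x, hx⟩ := H
  have hsub : ∀ s : K, (h : Matrix (Fin 3) (Fin 3) K) - scalar _ s =
      x⁻¹.1 * (((x * h * x⁻¹ : GL (Fin 3) K) : Matrix (Fin 3) (Fin 3) K)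
        - scalar _ s) * x.1 := by
    intro s
    have : (scalar (Fin 3) s) * (x : Matrix (Fin 3) (Fin 3) K) = x * scalar (Fin 3) s :=
      scalar_commute _ (Commute.all s) _
    rw [mul_sub, sub_mul, mul_assoc _ (scalar (Fin 3) s), this, Units.inv_mul_cancel_left,
      ← Units.val_mul, ← Units.val_mul]
    congr 2
    group
  refine ⟨(x * h * x⁻¹ : GL (Fin 3) K), ?_, ?_, ?_, ?_⟩
  · intro s t u e
    rw [hsub, hsub t, hsub u]
    simp only [mul_assoc, Units.mul_inv_cancel_left] at e ⊢
    generalize ((x * (h * x⁻¹) : GL (Fin 3) K) : Matrix (Fin 3) (Fin 3) K) = A at *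
    rw [← mul_assoc (A - scalar _ t), ← mul_assoc (A - scalar _ s), e]
    simp
  · intro s t e
    rw [hsub, hsub t]
    simp only [mul_assoc, Units.mul_inv_cancel_left] at e ⊢
    generalize ((x * (h * x⁻¹) : GL (Fin 3) K) : Matrix (Fin 3) (Fin 3) K) = A at *
    rw [← mul_assoc (A - scalar _ s), e]
    simp
  · intro s e
    rw [hsub, e]
    simp
  · intro Y hY hc
    let y : GL (Fin 3) K := Matrix.GeneralLinearGroup.mkOfDetNeZero Y hY
    have hy : y ∈ Subgroup.centralizer {g} :=
      Subgroup.mem_centralizer_singleton_iff.2 (Units.ext hc)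
    rw [hx, Subgroup.mem_map_equiv, Subgroup.mem_centralizer_singleton_iff,
      MulAut.conj_symm_apply] at hy
    have : y * (x * h * x⁻¹) = (x * h * x⁻¹) * y := by
      calc y * (x * h * x⁻¹) = x * ((x⁻¹ * y * x) * h) * x⁻¹ := by group
        _ = _ := by rw [hy]; group
    exact congrArg Units.val this

/-- Conjugation moving the eigenvector `(x, y, z)` with `x ≠ 0` to the first basis vector. -/
theorem isSimilar_block_of_apply_zero_ne_zero {M : Matrix (Fin 3) (Fin 3) K} {s : K}
    {v : Fin 3 → K} (e : M *ᵥ v = s • v) (h0 : v 0 ≠ 0) :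
    ∃ p q t r k u : K, IsSimilar M !![s, p, q; 0, t, r; 0, k, u] := by
  have e0 := congrFun e 0
  have e1 := congrFun e 1
  have e2 := congrFun e 2
  simp [mulVec, dotProduct, Fin.sum_univ_three] at e0 e1 e2
  refine ⟨M 0 1 / v 0, M 0 2 / v 0, M 1 1 - v 1 * (M 0 1 / v 0), M 1 2 - v 1 * (M 0 2 / v 0),
    M 2 1 - v 2 * (M 0 1 / v 0), M 2 2 - v 2 * (M 0 2 / v 0),
    !![v 0, 0, 0; v 1, 1, 0; v 2, 0, 1], by simp [det_fin_three, h0], ?_⟩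
  ext i j
  fin_cases i <;> fin_cases j <;> simp [mul_apply, Fin.sum_univ_three, mul_div_cancel₀, h0]
  · linear_combination e0
  · linear_combination e1
  · linear_combination e2

theorem isSimilar_submatrix (M : Matrix (Fin 3) (Fin 3) K) (σ : Equiv.Perm (Fin 3)) :
    IsSimilar M (M.submatrix σ σ) := by
  refine ⟨(1 : Matrix (Fin 3) (Fin 3) K).submatrix id σ, ?_, ?_⟩
  · rcases Int.units_eq_one_or (Equiv.Perm.sign σ) with h | h <;> simp [det_permute', h]
  · ext i j
    simp [mul_apply, one_apply, ← Equiv.symm_apply_eq]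
    simp [Equiv.symm_apply_eq]

theorem isSimilar_block [IsAlgClosed K] (M : Matrix (Fin 3) (Fin 3) K) :
    ∃ s p q t r k u : K, IsSimilar M !![s, p, q; 0, t, r; 0, k, u] := by
  obtain ⟨s, hs⟩ := Module.End.exists_eigenvalue (Matrix.toLin' M)
  obtain ⟨v, hv⟩ := hs.exists_hasEigenvector
  have e : M *ᵥ v = s • v := by simpa using hv.apply_eq_smul
  obtain ⟨i, hi⟩ := Function.ne_iff.1 hv.2
  let σ : Equiv.Perm (Fin 3) := Equiv.swap 0 i
  have e' : M.submatrix σ σ *ᵥ (v ∘ σ) = s • (v ∘ σ) := by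
    rw [submatrix_mulVec_equiv, Function.comp_assoc, Equiv.self_comp_symm, Function.comp_id, e]
    rfl
  obtain ⟨p, q, t, r, k, u, h⟩ :=
    isSimilar_block_of_apply_zero_ne_zero e' (by simpa [σ] using hi)
  exact ⟨s, p, q, t, r, k, u, (isSimilar_submatrix M σ).trans h⟩

theorem isSimilar_triangular [IsAlgClosed K] (M : Matrix (Fin 3) (Fin 3) K) :
    ∃ s p q t r u : K, IsSimilar M !![s, p, q; 0, t, r; 0, 0, u] := by
  obtain ⟨s, p, q, t, r, k, u, h⟩ := isSimilar_block M
  by_cases hk : k = 0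
  · exact ⟨s, p, q, t, r, u, hk ▸ h⟩
  obtain ⟨l, hl⟩ := Module.End.exists_eigenvalue (Matrix.toLin' !![t, r; k, u])
  obtain ⟨w, hw⟩ := hl.exists_hasEigenvector
  have e : !![t, r; k, u] *ᵥ w = l • w := by simpa using hw.apply_eq_smul
  have e0 := congrFun e 0
  have e1 := congrFun e 1
  simp [mulVec, dotProduct, Fin.sum_univ_two] at e0 e1
  have hw1 : w 1 ≠ 0 := fun h1 => hw.2 (by
    have h0 : w 0 = 0 := by simpa [h1, hk] using e1
    ext i; fin_cases i <;> assumption)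
  have hroot : (t - l) * (u - l) = r * k := by
    refine mul_right_cancel₀ hw1 ?_
    linear_combination (t - l) * e1 - k * e0
  refine ⟨s, p * (l - u) + q * k, p, l, 1, t - l + u, h.trans ⟨!![1, 0, 0; 0, l - u, 1; 0, k, 0],
    by simp [det_fin_three, hk], ?_⟩⟩
  ext i j
  fin_cases i <;> fin_cases j <;> simp [mul_apply, Fin.sum_univ_three] <;> grind

theorem isSimilar_jordan [IsAlgClosed K] (M : Matrix (Fin 3) (Fin 3) K) :
    (∃ s, IsSimilar M !![s, 0, 0; 0, s, 0; 0, 0, s]) ∨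
    (∃ s, IsSimilar M !![s, 1, 0; 0, s, 0; 0, 0, s]) ∨
    (∃ s t, s ≠ t ∧ IsSimilar M !![s, 0, 0; 0, s, 0; 0, 0, t]) ∨
    (∃ s, IsSimilar M !![s, 1, 0; 0, s, 1; 0, 0, s]) ∨
    (∃ s t, s ≠ t ∧ IsSimilar M !![s, 1, 0; 0, s, 0; 0, 0, t]) ∨
    (∃ s t u, s ≠ t ∧ s ≠ u ∧ t ≠ u ∧ IsSimilar M !![s, 0, 0; 0, t, 0; 0, 0, u]) := by
  obtain ⟨s, p, q, t, r, u, h⟩ := isSimilar_triangular M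
  have aux : ∀ P J : Matrix (Fin 3) (Fin 3) K, P.det ≠ 0 →
      !![s, p, q; 0, t, r; 0, 0, u] * P = P * J → IsSimilar M J :=
    fun P J hP e => h.trans ⟨P, hP, e⟩
  clear h
  by_cases hst : s = t
  · subst hst
    by_cases hsu : s = u
    · subst hsu
      by_cases hp : p = 0
      · by_cases hr : r = 0
        · by_cases hq : q = 0
          · refine .inl ⟨s, aux 1 _ (by simp) ?_⟩
            simp [hp, hq, hr]
          · refine .inr (.inl ⟨s, aux !![q, 0, 0; 0, 0, 1; 0, 1, 0] _
              (by simp [det_fin_three, hq]) ?_⟩)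
            ext i j
            fin_cases i <;> fin_cases j <;> simp [mul_apply, Fin.sum_univ_three] <;> grind
        · refine .inr (.inl ⟨s, aux !![q, 0, 1; r, 0, 0; 0, 1, 0] _
              (by simp [det_fin_three, hr]) ?_⟩)
          ext i j
          fin_cases i <;> fin_cases j <;> simp [mul_apply, Fin.sum_univ_three] <;> grind
      · by_cases hr : r = 0
        · refine .inr (.inl ⟨s, aux !![p, 0, 0; 0, 1, -q; 0, 0, p] _
              (by simp [det_fin_three, hp]) ?_⟩)
          ext i j
          fin_cases i <;> fin_cases j <;> simp [mul_apply, Fin.sum_univ_three] <;> grind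
        · refine .inr (.inr (.inr (.inl ⟨s, aux !![p * r, q, 0; 0, r, 0; 0, 0, 1] _
              (by simp [det_fin_three, hp, hr]) ?_⟩)))
          ext i j
          fin_cases i <;> fin_cases j <;> simp [mul_apply, Fin.sum_univ_three] <;> grind
    · by_cases hp : p = 0
      · refine .inr (.inr (.inl ⟨s, u, hsu, aux
          !![1, 0, p * r + q * (u - s); 0, 1, r * (u - s); 0, 0, (u - s) ^ 2] _
              (by simp [det_fin_three]; grind) ?_⟩))
        ext i j
        fin_cases i <;> fin_cases j <;> simp [mul_apply, Fin.sum_univ_three] <;> grind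
      · refine .inr (.inr (.inr (.inr (.inl ⟨s, u, hsu, aux
          !![p, 0, p * r + q * (u - s); 0, 1, r * (u - s); 0, 0, (u - s) ^ 2] _
              (by simp [det_fin_three]; grind) ?_⟩))))
        ext i j
        fin_cases i <;> fin_cases j <;> simp [mul_apply, Fin.sum_univ_three] <;> grind
  · by_cases hsu : s = u
    · subst hsu
      by_cases hk : p * r + q * (s - t) = 0
      · refine .inr (.inr (.inl ⟨s, t, hst, aux
          !![1, 0, p; 0, r, t - s; 0, s - t, 0] _
              (by simp [det_fin_three]; grind) ?_⟩))
        ext i j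
        fin_cases i <;> fin_cases j <;> simp [mul_apply, Fin.sum_univ_three] <;> grind
      · refine .inr (.inr (.inr (.inr (.inl ⟨s, t, hst, aux
          !![p * r + q * (s - t), 0, p; 0, r, t - s; 0, s - t, 0] _
              (by simp [det_fin_three]; grind) ?_⟩))))
        ext i j
        fin_cases i <;> fin_cases j <;> simp [mul_apply, Fin.sum_univ_three] <;> grind
    · by_cases htu : t = u
      · subst htu
        by_cases hr : r = 0
        · refine .inr (.inr (.inl ⟨t, s, Ne.symm hst, aux
            !![p, q * (t - s), 1; t - s, 0, 0; 0, (t - s) ^ 2, 0] _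
                (by simp [det_fin_three]; grind) ?_⟩))
          ext i j
          fin_cases i <;> fin_cases j <;> simp [mul_apply, Fin.sum_univ_three] <;> grind
        · refine .inr (.inr (.inr (.inr (.inl ⟨t, s, Ne.symm hst, aux
            !![r * (t - s) * p, q * (t - s) - r * p, 1; r * (t - s) * (t - s), 0, 0;
              0, (t - s) ^ 2, 0] _
                (by simp [det_fin_three]; grind) ?_⟩))))
          ext i j
          fin_cases i <;> fin_cases j <;> simp [mul_apply, Fin.sum_univ_three] <;> grind
      · refine .inr (.inr (.inr (.inr (.inr ⟨s, t, u, hst, hsu, htu, aux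
          !![1, p, p * r + q * (u - t); 0, t - s, r * (u - s); 0, 0, (u - s) * (u - t)] _
              (by simp [det_fin_three]; grind) ?_⟩))))
        ext i j
        fin_cases i <;> fin_cases j <;> simp [mul_apply, Fin.sum_univ_three] <;> grind

theorem commute_iff_entries (Y J : Matrix (Fin 3) (Fin 3) K) :
    Commute Y J ↔ ∀ i j, Y i 0 * J 0 j + Y i 1 * J 1 j + Y i 2 * J 2 j =
      J i 0 * Y 0 j + J i 1 * Y 1 j + J i 2 * Y 2 j := by
  simp [commute_iff_eq, ← Matrix.ext_iff, mul_apply, Fin.sum_univ_three]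

theorem commute_scalar_matrix (Y : Matrix (Fin 3) (Fin 3) K) (s : K) :
    Commute Y !![s, 0, 0; 0, s, 0; 0, 0, s] := by
  simp [commute_iff_entries, Fin.forall_fin_succ, mul_comm]

theorem commute_jordanTwoOne_iff (Y : Matrix (Fin 3) (Fin 3) K) (s : K) :
    Commute Y !![s, 1, 0; 0, s, 0; 0, 0, s] ↔
      Y 1 0 = 0 ∧ Y 2 0 = 0 ∧ Y 1 2 = 0 ∧ Y 0 0 = Y 1 1 := by
  simp [commute_iff_entries, Fin.forall_fin_succ]
  grind

theorem commute_diagTwoOne_iff (Y : Matrix (Fin 3) (Fin 3) K) {s t : K} (h : s ≠ t) :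
    Commute Y !![s, 0, 0; 0, s, 0; 0, 0, t] ↔
      Y 0 2 = 0 ∧ Y 1 2 = 0 ∧ Y 2 0 = 0 ∧ Y 2 1 = 0 := by
  simp [commute_iff_entries, Fin.forall_fin_succ]
  grind

theorem commute_jordanThree_iff (Y : Matrix (Fin 3) (Fin 3) K) (s : K) :
    Commute Y !![s, 1, 0; 0, s, 1; 0, 0, s] ↔
      Y 1 0 = 0 ∧ Y 2 0 = 0 ∧ Y 2 1 = 0 ∧ Y 0 0 = Y 1 1 ∧ Y 1 1 = Y 2 2 ∧ Y 0 1 = Y 1 2 := by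
  simp [commute_iff_entries, Fin.forall_fin_succ]
  grind

theorem commute_jordanTwoDiag_iff (Y : Matrix (Fin 3) (Fin 3) K) {s t : K} (h : s ≠ t) :
    Commute Y !![s, 1, 0; 0, s, 0; 0, 0, t] ↔
      Y 1 0 = 0 ∧ Y 0 0 = Y 1 1 ∧ Y 0 2 = 0 ∧ Y 1 2 = 0 ∧ Y 2 0 = 0 ∧ Y 2 1 = 0 := by
  simp [commute_iff_entries, Fin.forall_fin_succ]
  grind

theorem commute_diagonal_iff (Y : Matrix (Fin 3) (Fin 3) K) {s t u : K} (hst : s ≠ t)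
    (hsu : s ≠ u) (htu : t ≠ u) :
    Commute Y !![s, 0, 0; 0, t, 0; 0, 0, u] ↔
      Y 0 1 = 0 ∧ Y 0 2 = 0 ∧ Y 1 0 = 0 ∧ Y 1 2 = 0 ∧ Y 2 0 = 0 ∧ Y 2 1 = 0 := by
  simp [commute_iff_entries, Fin.forall_fin_succ]
  grind

section Annihilators

variable {h : GL (Fin 3) K} {g : GL (Fin 3) K}

theorem annihilated_of_isZEquiv_scalar (H : IsZEquiv g h) {a : K}
    (hg : (g : Matrix (Fin 3) (Fin 3) K) = !![a, 0, 0; 0, a, 0; 0, 0, a]) :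
    ∃ s : K, (h : Matrix (Fin 3) (Fin 3) K) - scalar _ s = 0 := by
  obtain ⟨k, -, -, hk, hc⟩ := exists_commute_of_isZEquiv H
  simp only [hg, commute_scalar_matrix, forall_true_left] at hc
  have c1 := hc !![1, 1, 0; 0, 1, 0; 0, 0, 1] (by simp [det_fin_three])
  have c2 := hc !![1, 0, 0; 0, 1, 1; 0, 0, 1] (by simp [det_fin_three])
  have c3 := hc !![1, 0, 0; 0, 1, 0; 1, 0, 1] (by simp [det_fin_three])
  simp [commute_iff_entries, Fin.forall_fin_succ] at c1 c2 c3
  refine ⟨k 0 0, hk _ ?_⟩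
  ext i j
  fin_cases i <;> fin_cases j <;> simp <;> grind

theorem annihilated_of_isZEquiv_jordanTwoOne (H : IsZEquiv g h) {a : K}
    (hg : (g : Matrix (Fin 3) (Fin 3) K) = !![a, 1, 0; 0, a, 0; 0, 0, a]) :
    ∃ s : K, ((h : Matrix (Fin 3) (Fin 3) K) - scalar _ s) * (h.1 - scalar _ s) = 0 := by
  obtain ⟨k, -, hk, -, hc⟩ := exists_commute_of_isZEquiv H
  simp only [hg, commute_jordanTwoOne_iff] at hc
  have c1 := hc !![1, 1, 0; 0, 1, 0; 0, 0, 1] (by simp [det_fin_three]) (by simp)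
  have c2 := hc !![1, 0, 1; 0, 1, 0; 0, 0, 1] (by simp [det_fin_three]) (by simp)
  have c3 := hc !![1, 0, 0; 0, 1, 0; 0, 1, 1] (by simp [det_fin_three]) (by simp)
  simp [commute_iff_entries, Fin.forall_fin_succ] at c1 c2 c3
  refine ⟨k 0 0, hk _ _ ?_⟩
  ext i j
  fin_cases i <;> fin_cases j <;> simp [mul_apply, Fin.sum_univ_three] <;> grind

theorem annihilated_of_isZEquiv_diagTwoOne (H : IsZEquiv g h) {a b : K} (hab : a ≠ b)
    (hg : (g : Matrix (Fin 3) (Fin 3) K) = !![a, 0, 0; 0, a, 0; 0, 0, b]) :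
    ∃ s t : K, ((h : Matrix (Fin 3) (Fin 3) K) - scalar _ s) * (h.1 - scalar _ t) = 0 := by
  obtain ⟨k, -, hk, -, hc⟩ := exists_commute_of_isZEquiv H
  have c0 := (hc g (by simpa using g.det.ne_zero) (Commute.refl _)).symm
  rw [hg, commute_diagTwoOne_iff _ hab] at c0
  simp only [hg, commute_diagTwoOne_iff _ hab] at hc
  have c1 := hc !![1, 1, 0; 0, 1, 0; 0, 0, 1] (by simp [det_fin_three]) (by simp)
  have c2 := hc !![1, 0, 0; 1, 1, 0; 0, 0, 1] (by simp [det_fin_three]) (by simp)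
  simp [commute_iff_entries, Fin.forall_fin_succ] at c1 c2
  refine ⟨k 0 0, k 2 2, hk _ _ ?_⟩
  ext i j
  fin_cases i <;> fin_cases j <;> simp [mul_apply, Fin.sum_univ_three] <;> grind

theorem annihilated_of_isZEquiv_jordanThree (H : IsZEquiv g h) {a : K}
    (hg : (g : Matrix (Fin 3) (Fin 3) K) = !![a, 1, 0; 0, a, 1; 0, 0, a]) :
    ∃ s : K, ((h : Matrix (Fin 3) (Fin 3) K) - scalar _ s) * (h.1 - scalar _ s) *
      (h.1 - scalar _ s) = 0 := by
  obtain ⟨k, hk, -, -, hc⟩ := exists_commute_of_isZEquiv H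
  have c0 := (hc g (by simpa using g.det.ne_zero) (Commute.refl _)).symm
  rw [hg, commute_jordanThree_iff] at c0
  refine ⟨k 0 0, hk _ _ _ ?_⟩
  ext i j
  fin_cases i <;> fin_cases j <;> simp [mul_apply, Fin.sum_univ_three] <;> grind

theorem annihilated_of_isZEquiv_jordanTwoDiag (H : IsZEquiv g h) {a b : K} (hab : a ≠ b)
    (hg : (g : Matrix (Fin 3) (Fin 3) K) = !![a, 1, 0; 0, a, 0; 0, 0, b]) :
    ∃ s t : K, ((h : Matrix (Fin 3) (Fin 3) K) - scalar _ s) * (h.1 - scalar _ s) *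
      (h.1 - scalar _ t) = 0 := by
  obtain ⟨k, hk, -, -, hc⟩ := exists_commute_of_isZEquiv H
  have c0 := (hc g (by simpa using g.det.ne_zero) (Commute.refl _)).symm
  rw [hg, commute_jordanTwoDiag_iff _ hab] at c0
  refine ⟨k 0 0, k 2 2, hk _ _ _ ?_⟩
  ext i j
  fin_cases i <;> fin_cases j <;> simp [mul_apply, Fin.sum_univ_three] <;> grind

end Annihilators

end ZClassesGL3

/-- Over an algebraically closed field `K`, `GL₃(K)` has exactly `6` `z`-classes, represented
by `aI₃`; `a(I₂ ⊕ J₂)` (one Jordan block of size `2`); `diag(a,a,b)`; a single Jordan block of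
size `3`; a Jordan block of size `2` together with a distinct eigenvalue `b`; and `diag(a,b,c)`
with pairwise distinct entries. -/
theorem zclasses_GL3 {K : Type*} [Field K] [IsAlgClosed K]
    (a b c : K) (hab : a ≠ b) (hac : a ≠ c) (hbc : b ≠ c)
    (v : Fin 6 → GL (Fin 3) K)
    (h₀ : (↑(v 0) : Matrix (Fin 3) (Fin 3) K) = !![a, 0, 0; 0, a, 0; 0, 0, a])
    (h₁ : (↑(v 1) : Matrix (Fin 3) (Fin 3) K) = !![a, 1, 0; 0, a, 0; 0, 0, a])
    (h₂ : (↑(v 2) : Matrix (Fin 3) (Fin 3) K) = !![a, 0, 0; 0, a, 0; 0, 0, b])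
    (h₃ : (↑(v 3) : Matrix (Fin 3) (Fin 3) K) = !![a, 1, 0; 0, a, 1; 0, 0, a])
    (h₄ : (↑(v 4) : Matrix (Fin 3) (Fin 3) K) = !![a, 1, 0; 0, a, 0; 0, 0, b])
    (h₅ : (↑(v 5) : Matrix (Fin 3) (Fin 3) K) = !![a, 0, 0; 0, b, 0; 0, 0, c]) :
    (∀ g : GL (Fin 3) K, ∃ i : Fin 6, IsZEquiv g (v i)) ∧
      (∀ i j : Fin 6, i ≠ j → ¬ IsZEquiv (v i) (v j)) := by
  open ZClassesGL3 in
  constructor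
  · intro g
    rcases isSimilar_jordan (g : Matrix (Fin 3) (Fin 3) K) with
      ⟨s, h⟩ | ⟨s, h⟩ | ⟨s, t, hst, h⟩ | ⟨s, h⟩ | ⟨s, t, hst, h⟩ | ⟨s, t, u, hst, hsu, htu, h⟩
    · exact ⟨0, isZEquiv_of_isSimilar (h := v 0) h fun Y => by simp only [h₀, commute_scalar_matrix]⟩
    · exact ⟨1, isZEquiv_of_isSimilar (h := v 1) h fun Y => by simp only [h₁, commute_jordanTwoOne_iff]⟩
    · exact ⟨2, isZEquiv_of_isSimilar (h := v 2) h fun Y => by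
        rw [h₂, commute_diagTwoOne_iff _ hst, commute_diagTwoOne_iff _ hab]⟩
    · exact ⟨3, isZEquiv_of_isSimilar (h := v 3) h fun Y => by simp only [h₃, commute_jordanThree_iff]⟩
    · exact ⟨4, isZEquiv_of_isSimilar (h := v 4) h fun Y => by
        rw [h₄, commute_jordanTwoDiag_iff _ hst, commute_jordanTwoDiag_iff _ hab]⟩
    · exact ⟨5, isZEquiv_of_isSimilar (h := v 5) h fun Y => by
        rw [h₅, commute_diagonal_iff _ hst hsu htu, commute_diagonal_iff _ hab hac hbc]⟩
  · have lt : ∀ i j : Fin 6, i < j → ¬ IsZEquiv (v i) (v j) := by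
      intro i j hij H
      fin_cases i <;> dsimp only [Fin.reduceFinMk, Fin.zero_eta, Fin.mk_one] at hij H
      · fin_cases j <;> simp at hij H <;>
          obtain ⟨s, e⟩ := annihilated_of_isZEquiv_scalar H h₀ <;>
          simp [h₁, h₂, h₃, h₄, h₅, ← Matrix.ext_iff, Fin.forall_fin_succ] at e <;> grind
      · fin_cases j <;> simp at hij H <;>
          obtain ⟨s, e⟩ := annihilated_of_isZEquiv_jordanTwoOne H h₁ <;>
          simp [h₂, h₃, h₄, h₅, ← Matrix.ext_iff, Fin.forall_fin_succ, Matrix.mul_apply,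
            Fin.sum_univ_three] at e <;> grind
      · fin_cases j <;> simp at hij H <;>
          obtain ⟨s, t, e⟩ := annihilated_of_isZEquiv_diagTwoOne H hab h₂ <;>
          simp [h₃, h₄, h₅, ← Matrix.ext_iff, Fin.forall_fin_succ, Matrix.mul_apply,
            Fin.sum_univ_three] at e <;> grind
      · fin_cases j <;> simp at hij H <;>
          obtain ⟨s, e⟩ := annihilated_of_isZEquiv_jordanThree H h₃ <;>
          simp [h₄, h₅, ← Matrix.ext_iff, Fin.forall_fin_succ, Matrix.mul_apply,
            Fin.sum_univ_three] at e <;> grind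
      · fin_cases j <;> simp at hij H
        obtain ⟨s, t, e⟩ := annihilated_of_isZEquiv_jordanTwoDiag H hab h₄
        simp [h₅, ← Matrix.ext_iff, Fin.forall_fin_succ, Matrix.mul_apply,
          Fin.sum_univ_three] at e
        grind
      · fin_cases j <;> simp at hij
    intro i j hij H
    rcases lt_or_gt_of_ne hij with h | h
    · exact lt i j h H
    · exact lt j i h (isZEquiv_symm H)
end
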